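/- In the language λF_{S,v} of System F with shift and reset, the call-by-value reduction rules preserve types: if a well-typed program p reduces in one step to p' by →v, then p' is well-typed with the same type. -/

import Mathlib

/-!
Language `λF_{S,v}`: explicitly typed System F extended with the
delimited-control operators shift (`S k.t`), reset (`⟨t⟩`) and throw
(`k ← t`, `⌈E⌉ ← t`), under call by value, in de Bruijn representation
(separate de Bruijn indices for term variables, continuation variables and
type variables).
-/

namespace LambdaFShift

/-- Term types: `S ::= α | (S/T → U/V) | ∀α.(S,T,U)`.
In `∀α.(S,T,U)` the quantifier binds `α` in all three components. -/
inductive Ty : Type where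
  | var : Nat → Ty
  | arrow : Ty → Ty → Ty → Ty → Ty
  | all : Ty → Ty → Ty → Ty

/-- Lifting of a renaming under a binder. -/
def liftRen (ρ : Nat → Nat) : Nat → Nat
  | 0 => 0
  | n+1 => ρ n + 1

/-- Renaming of type variables in a type. -/
def renTy (ρ : Nat → Nat) : Ty → Ty
  | .var n => .var (ρ n)
  | .arrow a b c d => .arrow (renTy ρ a) (renTy ρ b) (renTy ρ c) (renTy ρ d)
  | .all a b c => .all (renTy (liftRen ρ) a) (renTy (liftRen ρ) b) (renTy (liftRen ρ) c)

/-- Lifting of a type substitution under a type binder. -/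
def liftTySub (σ : Nat → Ty) : Nat → Ty
  | 0 => .var 0
  | n+1 => renTy Nat.succ (σ n)

/-- Simultaneous substitution of types for type variables in a type. -/
def subTy (σ : Nat → Ty) : Ty → Ty
  | .var n => σ n
  | .arrow a b c d => .arrow (subTy σ a) (subTy σ b) (subTy σ c) (subTy σ d)
  | .all a b c => .all (subTy (liftTySub σ) a) (subTy (liftTySub σ) b) (subTy (liftTySub σ) c)

/-- `subTy0 U S` is `S[α₀ := U]`. -/
def subTy0 (U : Ty) (S : Ty) : Ty :=
  subTy (fun n => match n with | 0 => U | n+1 => .var n) S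

/-- `subTyList Ts S` is `S[ᾱ := Ts]`. -/
def subTyList (Ts : List Ty) (S : Ty) : Ty :=
  subTy (fun n => Ts.getD n (.var n)) S

/-- `ScopedTy p S`: all free type variables of `S` are `< p`. -/
inductive ScopedTy : Nat → Ty → Prop where
  | var : ∀ {p n}, n < p → ScopedTy p (.var n)
  | arrow : ∀ {p a b c d}, ScopedTy p a → ScopedTy p b → ScopedTy p c → ScopedTy p d →
      ScopedTy p (.arrow a b c d)
  | all : ∀ {p a b c}, ScopedTy (p+1) a → ScopedTy (p+1) b → ScopedTy (p+1) c →
      ScopedTy p (.all a b c)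

/-- A closed type. -/
def ClosedTy (S : Ty) : Prop := ScopedTy 0 S

mutual
/-- Terms of `λF_{S,v}`: variables, `λx:S.t`, application, `Λα.t`, type
application, `S k.t` (shift), `⟨t⟩` (reset), `k ← t` and `⌈E⌉ ← t` (throw). -/
inductive Tm : Type where
  | var : Nat → Tm
  | lam : Ty → Tm → Tm
  | app : Tm → Tm → Tm
  | tlam : Tm → Tm
  | tapp : Tm → Ty → Tm
  | shift : Tm → Tm
  | reset : Tm → Tm
  | throwVar : Nat → Tm → Tm
  | throwCtx : Ctx → Tm → Tm

/-- Call-by-value evaluation contexts, represented inside-out: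
`[]`, `(λx:S.t)·E`, `E t`, `E S`, `⌈E₀⌉ ← E`. -/
inductive Ctx : Type where
  | hole : Ctx
  | lamApp : Ty → Tm → Ctx → Ctx
  | app : Ctx → Tm → Ctx
  | tapp : Ctx → Ty → Ctx
  | throw : Ctx → Ctx → Ctx
end

/-- Metacontexts: stacks of contexts, `F ::= • | E·F`. -/
abbrev MCtx : Type := List Ctx

/-- Plugging a term in a context. -/
def plug : Tm → Ctx → Tm
  | t, .hole => t
  | t, .lamApp S b E => plug (.app (.lam S b) t) E
  | t, .app E u => plug (.app t u) E
  | t, .tapp E S => plug (.tapp t S) E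
  | t, .throw E0 E => plug (.throwCtx E0 t) E

/-- Plugging a term in a metacontext:
`plugm t • = t` and `plugm t (E·F) = plugm ⟨E[t]⟩ F`.
In particular `plugm t (E::F)` is `F[⟨E[t]⟩]`. -/
def plugm : Tm → MCtx → Tm
  | t, [] => t
  | t, E :: F => plugm (.reset (plug t E)) F

/-- Values: λ-abstractions and Λ-abstractions. -/
inductive IsValue : Tm → Prop where
  | lam : ∀ {S t}, IsValue (.lam S t)
  | tlam : ∀ {t}, IsValue (.tlam t)

/-- Plain terms: no subterm of the form `⌈E⌉ ← t`. -/
inductive Plain : Tm → Prop where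
  | var : ∀ {n}, Plain (.var n)
  | lam : ∀ {S t}, Plain t → Plain (.lam S t)
  | app : ∀ {a b}, Plain a → Plain b → Plain (.app a b)
  | tlam : ∀ {t}, Plain t → Plain (.tlam t)
  | tapp : ∀ {t S}, Plain t → Plain (.tapp t S)
  | shift : ∀ {t}, Plain t → Plain (.shift t)
  | reset : ∀ {t}, Plain t → Plain (.reset t)
  | throwVar : ∀ {k t}, Plain t → Plain (.throwVar k t)

mutual
/-- Scoping predicate for terms: free term variables `< n`, free continuation
variables `< m`, free type variables `< p`. -/
inductive ScTm : Nat → Nat → Nat → Tm → Prop where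
  | var : ∀ {n m p x}, x < n → ScTm n m p (.var x)
  | lam : ∀ {n m p S t}, ScopedTy p S → ScTm (n+1) m p t → ScTm n m p (.lam S t)
  | app : ∀ {n m p a b}, ScTm n m p a → ScTm n m p b → ScTm n m p (.app a b)
  | tlam : ∀ {n m p t}, ScTm n m (p+1) t → ScTm n m p (.tlam t)
  | tapp : ∀ {n m p t S}, ScTm n m p t → ScopedTy p S → ScTm n m p (.tapp t S)
  | shift : ∀ {n m p t}, ScTm n (m+1) p t → ScTm n m p (.shift t)
  | reset : ∀ {n m p t}, ScTm n m p t → ScTm n m p (.reset t)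
  | throwVar : ∀ {n m p k t}, k < m → ScTm n m p t → ScTm n m p (.throwVar k t)
  | throwCtx : ∀ {n m p E t}, ScCtx n m p E → ScTm n m p t → ScTm n m p (.throwCtx E t)

/-- Scoping predicate for contexts. -/
inductive ScCtx : Nat → Nat → Nat → Ctx → Prop where
  | hole : ∀ {n m p}, ScCtx n m p .hole
  | lamApp : ∀ {n m p S t E}, ScopedTy p S → ScTm (n+1) m p t → ScCtx n m p E →
      ScCtx n m p (.lamApp S t E)
  | app : ∀ {n m p E t}, ScCtx n m p E → ScTm n m p t → ScCtx n m p (.app E t)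
  | tapp : ∀ {n m p E S}, ScCtx n m p E → ScopedTy p S → ScCtx n m p (.tapp E S)
  | throw : ∀ {n m p E0 E1}, ScCtx n m p E0 → ScCtx n m p E1 → ScCtx n m p (.throw E0 E1)
end

/-- A closed term. -/
def ClosedTm (t : Tm) : Prop := ScTm 0 0 0 t

/-- A closed context. -/
def ClosedCtx (E : Ctx) : Prop := ScCtx 0 0 0 E

/-- A closed metacontext. -/
def ClosedMCtx (F : MCtx) : Prop := ∀ E ∈ F, ClosedCtx E

mutual
/-- Renaming of the three kinds of variables in terms. -/
def renTm (ρx ρk ρa : Nat → Nat) : Tm → Tm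
  | .var n => .var (ρx n)
  | .lam S t => .lam (renTy ρa S) (renTm (liftRen ρx) ρk ρa t)
  | .app a b => .app (renTm ρx ρk ρa a) (renTm ρx ρk ρa b)
  | .tlam t => .tlam (renTm ρx ρk (liftRen ρa) t)
  | .tapp t S => .tapp (renTm ρx ρk ρa t) (renTy ρa S)
  | .shift t => .shift (renTm ρx (liftRen ρk) ρa t)
  | .reset t => .reset (renTm ρx ρk ρa t)
  | .throwVar k t => .throwVar (ρk k) (renTm ρx ρk ρa t)
  | .throwCtx E t => .throwCtx (renCtx ρx ρk ρa E) (renTm ρx ρk ρa t)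

/-- Renaming of the three kinds of variables in contexts. -/
def renCtx (ρx ρk ρa : Nat → Nat) : Ctx → Ctx
  | .hole => .hole
  | .lamApp S t E => .lamApp (renTy ρa S) (renTm (liftRen ρx) ρk ρa t) (renCtx ρx ρk ρa E)
  | .app E t => .app (renCtx ρx ρk ρa E) (renTm ρx ρk ρa t)
  | .tapp E S => .tapp (renCtx ρx ρk ρa E) (renTy ρa S)
  | .throw E0 E => .throw (renCtx ρx ρk ρa E0) (renCtx ρx ρk ρa E)
end

/-- Action of a context transformer on continuation-substitution entries. -/
def mapKEnt (f : Ctx → Ctx) : Ctx ⊕ Nat → Ctx ⊕ Nat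
  | .inl E => .inl (f E)
  | .inr n => .inr n

/-- Lifting of a term substitution under a term binder. -/
def liftSubX (σ : Nat → Tm) : Nat → Tm
  | 0 => .var 0
  | n+1 => renTm Nat.succ id id (σ n)

/-- Shifting of a term substitution under a continuation binder. -/
def shiftSubXk (σ : Nat → Tm) : Nat → Tm := fun n => renTm id Nat.succ id (σ n)

/-- Shifting of a term substitution under a type binder. -/
def shiftSubXa (σ : Nat → Tm) : Nat → Tm := fun n => renTm id id Nat.succ (σ n)

/-- Lifting of a continuation substitution under a continuation binder. -/
def liftSubK (σ : Nat → Ctx ⊕ Nat) : Nat → Ctx ⊕ Nat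
  | 0 => .inr 0
  | n+1 =>
    match σ n with
    | .inl E => .inl (renCtx id Nat.succ id E)
    | .inr m => .inr (m+1)

/-- Shifting of a continuation substitution under a term binder. -/
def shiftSubKx (σ : Nat → Ctx ⊕ Nat) : Nat → Ctx ⊕ Nat :=
  fun n => mapKEnt (renCtx Nat.succ id id) (σ n)

/-- Shifting of a continuation substitution under a type binder. -/
def shiftSubKa (σ : Nat → Ctx ⊕ Nat) : Nat → Ctx ⊕ Nat :=
  fun n => mapKEnt (renCtx id id Nat.succ) (σ n)

mutual
/-- Simultaneous capture-avoiding substitution in terms. -/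
def subTm (σx : Nat → Tm) (σk : Nat → Ctx ⊕ Nat) (σa : Nat → Ty) : Tm → Tm
  | .var n => σx n
  | .lam S t => .lam (subTy σa S) (subTm (liftSubX σx) (shiftSubKx σk) σa t)
  | .app a b => .app (subTm σx σk σa a) (subTm σx σk σa b)
  | .tlam t => .tlam (subTm (shiftSubXa σx) (shiftSubKa σk) (liftTySub σa) t)
  | .tapp t S => .tapp (subTm σx σk σa t) (subTy σa S)
  | .shift t => .shift (subTm (shiftSubXk σx) (liftSubK σk) σa t)
  | .reset t => .reset (subTm σx σk σa t)
  | .throwVar k t =>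
    match σk k with
    | .inl E => .throwCtx E (subTm σx σk σa t)
    | .inr m => .throwVar m (subTm σx σk σa t)
  | .throwCtx E t => .throwCtx (subCtx σx σk σa E) (subTm σx σk σa t)

/-- Simultaneous capture-avoiding substitution in contexts. -/
def subCtx (σx : Nat → Tm) (σk : Nat → Ctx ⊕ Nat) (σa : Nat → Ty) : Ctx → Ctx
  | .hole => .hole
  | .lamApp S t E => .lamApp (subTy σa S) (subTm (liftSubX σx) (shiftSubKx σk) σa t) (subCtx σx σk σa E)
  | .app E t => .app (subCtx σx σk σa E) (subTm σx σk σa t)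
  | .tapp E S => .tapp (subCtx σx σk σa E) (subTy σa S)
  | .throw E0 E => .throw (subCtx σx σk σa E0) (subCtx σx σk σa E)
end

/-- `sub0X v t` is `t[x₀ := v]`. -/
def sub0X (v : Tm) (t : Tm) : Tm :=
  subTm (fun n => match n with | 0 => v | n+1 => .var n) Sum.inr Ty.var t

/-- `sub0A S t` is `t[α₀ := S]`. -/
def sub0A (S : Ty) (t : Tm) : Tm :=
  subTm Tm.var Sum.inr (fun n => match n with | 0 => S | n+1 => .var n) t

/-- `sub0K E t` is `t[k₀ := ⌈E⌉]`. -/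
def sub0K (E : Ctx) (t : Tm) : Tm :=
  subTm Tm.var (fun n => match n with | 0 => .inl E | n+1 => .inr n) Ty.var t

/-- `msub Vs vs Es t` is the simultaneous substitution
`t[ᾱ := Vs][x̄ := vs][k̄ := ⌈Es⌉]`. -/
def msub (Vs : List Ty) (vs : List Tm) (Es : List Ctx) (t : Tm) : Tm :=
  subTm (fun n => vs.getD n (.var n))
        (fun n => match Es[n]? with | some E => .inl E | none => .inr n)
        (fun n => Vs.getD n (.var n)) t

mutual
/-- The type system of Figure 2: typing of terms.
`HasTy Γ Δ T t S U` encodes the judgment `Γ;Δ,T ⊢ t : S,U`, where `Γ` assigns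
term types to term variables and `Δ` assigns context types `¬(S,T)`
(represented by the pair `(S,T)`) to continuation variables. -/
inductive HasTy : List Ty → List (Ty × Ty) → Ty → Tm → Ty → Ty → Prop where
  | var : ∀ {Γ Δ x S T}, Γ[x]? = some S → HasTy Γ Δ T (.var x) S T
  | lam : ∀ {Γ Δ S T U V W t}, HasTy (S::Γ) Δ U t T V →
      HasTy Γ Δ W (.lam S t) (.arrow S T U V) W
  | app : ∀ {Γ Δ S T U V W X t0 t1},
      HasTy Γ Δ X t0 (.arrow S T U W) V → HasTy Γ Δ W t1 S X →
      HasTy Γ Δ U (.app t0 t1) T V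
  | tlam : ∀ {Γ Δ S T U V t},
      HasTy (Γ.map (renTy Nat.succ)) (Δ.map (fun C => (renTy Nat.succ C.1, renTy Nat.succ C.2))) T t S U →
      HasTy Γ Δ V (.tlam t) (.all S T U) V
  | tapp : ∀ {Γ Δ S T U V W t},
      HasTy Γ Δ (subTy0 V U) t (.all S T U) W →
      HasTy Γ Δ (subTy0 V T) (.tapp t V) (subTy0 V S) W
  | reset : ∀ {Γ Δ S T U t}, HasTy Γ Δ U t U S → HasTy Γ Δ T (.reset t) S T
  | shift : ∀ {Γ Δ S T U V t}, HasTy Γ ((S,T)::Δ) V t V U →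
      HasTy Γ Δ T (.shift t) S U
  | throwVar : ∀ {Γ Δ k S T U V t}, Δ[k]? = some (S,T) → HasTy Γ Δ U t S V →
      HasTy Γ Δ U (.throwVar k t) T V
  | throwCtx : ∀ {Γ Δ E S T U V t}, HasTyCtx Γ Δ E S T → HasTy Γ Δ U t S V →
      HasTy Γ Δ U (.throwCtx E t) T V

/-- The type system of Figure 2: typing of contexts.
`HasTyCtx Γ Δ E S T` encodes `Γ;Δ ⊢ E : ¬(S,T)`. -/
inductive HasTyCtx : List Ty → List (Ty × Ty) → Ctx → Ty → Ty → Prop where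
  | hole : ∀ {Γ Δ S}, HasTyCtx Γ Δ .hole S S
  | app : ∀ {Γ Δ S T U V W t E},
      HasTyCtx Γ Δ E T U → HasTy Γ Δ V t S W →
      HasTyCtx Γ Δ (.app E t) (.arrow S T U V) W
  | lamApp : ∀ {Γ Δ S T U V W t E},
      HasTy Γ Δ W (.lam S t) (.arrow S T U V) W → HasTyCtx Γ Δ E T U →
      HasTyCtx Γ Δ (.lamApp S t E) S V
  | tapp : ∀ {Γ Δ S T U V E},
      HasTyCtx Γ Δ E (subTy0 V S) (subTy0 V T) →
      HasTyCtx Γ Δ (.tapp E V) (.all S T U) (subTy0 V U)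
  | throw : ∀ {Γ Δ S T U E' E},
      HasTyCtx Γ Δ E' S T → HasTyCtx Γ Δ E T U →
      HasTyCtx Γ Δ (.throw E' E) S U
end

/-- The type system of Figure 2: typing of metacontexts.
`HasTyMCtx Γ Δ F S` encodes `Γ;Δ ⊢ F : ¬¬S`. -/
inductive HasTyMCtx : List Ty → List (Ty × Ty) → MCtx → Ty → Prop where
  | nil : ∀ {Γ Δ S}, HasTyMCtx Γ Δ ([] : MCtx) S
  | cons : ∀ {Γ Δ S T E F}, HasTyCtx Γ Δ E S T → HasTyMCtx Γ Δ F T →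
      HasTyMCtx Γ Δ (E :: F : MCtx) S

/-- The call-by-value one-step reduction relation `→v` of `λF_{S,v}`.
Note that `plugm r (E::F)` is the program `F[⟨E[r]⟩]`. -/
inductive Step : Tm → Tm → Prop where
  | beta : ∀ {S t v E F}, IsValue v →
      Step (plugm (.app (.lam S t) v) (E::F)) (plugm (sub0X v t) (E::F))
  | betaT : ∀ {t S E F},
      Step (plugm (.tapp (.tlam t) S) (E::F)) (plugm (sub0A S t) (E::F))
  | shift : ∀ {t E F},
      Step (plugm (.shift t) (E::F)) (plugm (.reset (sub0K E t)) F)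
  | throw : ∀ {E' E F v}, IsValue v →
      Step (plugm (.throwCtx E' v) (E::F)) (plugm v (E'::E::F))
  | reset : ∀ {v E F}, IsValue v →
      Step (plugm (.reset v) (E::F)) (plugm v (E::F))

/-- Call-by-value evaluation: the reflexive-transitive closure of `→v`. -/
def Steps : Tm → Tm → Prop := Relation.ReflTransGen Step

/-- Redexes of `λF_{S,v}` under call by value. -/
inductive IsRedex : Tm → Prop where
  | beta : ∀ {S t v}, IsValue v → IsRedex (.app (.lam S t) v)
  | betaT : ∀ {t S}, IsRedex (.tapp (.tlam t) S)
  | shift : ∀ {t}, IsRedex (.shift t)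
  | throw : ∀ {E v}, IsValue v → IsRedex (.throwCtx E v)
  | reset : ∀ {v}, IsValue v → IsRedex (.reset v)

/-- `Norm p`: the program `p` evaluates to a value delimited by a reset. -/
def Norm (p : Tm) : Prop := ∃ v, IsValue v ∧ Steps p (.reset v)

/-- A reducibility candidate of type `S` is a set of closed values of type `S`. -/
def IsCand (S : Ty) (R : Set Tm) : Prop :=
  ∀ v ∈ R, IsValue v ∧ ClosedTm v ∧ ∀ W, HasTy [] [] W v S W

/-- `MCtxOK R F` is the predicate `R ⊨⊨ F`, i.e. `∀ v ∈ R, norm (F[⟨v⟩])`. -/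
def MCtxOK (R : Set Tm) (F : MCtx) : Prop := ∀ v ∈ R, Norm (plugm (.reset v) F)

/-- `MCtxAdm U R F`: `F` is a closed metacontext of type `¬¬U` with `R ⊨⊨ F`. -/
def MCtxAdm (U : Ty) (R : Set Tm) (F : MCtx) : Prop :=
  ClosedMCtx F ∧ HasTyMCtx [] [] F U ∧ MCtxOK R F

/-- `CtxOK T R R' E` is the predicate `(R,R') ⊨ E`:
`∀ v ∈ R, ∀ F, R' ⊨⊨ F → norm (F[⟨E[v]⟩])`, where `T` is the type of the
candidate `R'` (so the metacontexts `F` range over closed metacontexts of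
type `¬¬T`). -/
def CtxOK (T : Ty) (R R' : Set Tm) (E : Ctx) : Prop :=
  ∀ v ∈ R, ∀ F, MCtxAdm T R' F → Norm (plugm v (E::F))

/-- `CtxAdm S T R R' E`: `E` is a closed context of type `¬(S,T)` with `(R,R') ⊨ E`. -/
def CtxAdm (S T : Ty) (R R' : Set Tm) (E : Ctx) : Prop :=
  ClosedCtx E ∧ HasTyCtx [] [] E S T ∧ CtxOK T R R' E

/-- The parametric reducibility candidate `RED_S(ᾱ ↦ R̄)` for `λF_{S,v}`,
defined by induction on `S`.  `Ts` are the types of the candidates `Rs`. -/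
def RED : Ty → List Ty → List (Set Tm) → Set Tm
  | .var i, _, Rs => Rs.getD i ∅
  | .arrow S T U V, Ts, Rs =>
      {v0 | IsValue v0 ∧ ClosedTm v0 ∧ (∀ W, HasTy [] [] W v0 (subTyList Ts (.arrow S T U V)) W) ∧
        ∀ v1 ∈ RED S Ts Rs,
          ∀ E, CtxAdm (subTyList Ts T) (subTyList Ts U) (RED T Ts Rs) (RED U Ts Rs) E →
          ∀ F, MCtxAdm (subTyList Ts V) (RED V Ts Rs) F →
            Norm (plugm (.app v0 v1) (E::F))}
  | .all S T U, Ts, Rs =>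
      {v | IsValue v ∧ ClosedTm v ∧ (∀ W, HasTy [] [] W v (subTyList Ts (.all S T U)) W) ∧
        ∀ (V : Ty) (Rc : Set Tm), IsCand V Rc →
          ∀ E, CtxAdm (subTyList (V::Ts) S) (subTyList (V::Ts) T)
                 (RED S (V::Ts) (Rc::Rs)) (RED T (V::Ts) (Rc::Rs)) E →
          ∀ F, MCtxAdm (subTyList (V::Ts) U) (RED U (V::Ts) (Rc::Rs)) F →
            Norm (plugm (.tapp v V) (E::F))}

end LambdaFShift
namespace LambdaFShift

/-! ### Algebra of type renamings and substitutions -/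

theorem liftRen_comp (ρ ρ' : Nat → Nat) : liftRen ρ ∘ liftRen ρ' = liftRen (ρ ∘ ρ') := by
  funext n; cases n <;> rfl

theorem liftRen_id : liftRen id = id := by
  funext n; cases n <;> rfl

theorem renTy_id (S : Ty) : renTy id S = S := by
  induction S <;> simp_all [renTy, liftRen_id]

theorem renTy_renTy (S : Ty) (ρ ρ' : Nat → Nat) : renTy ρ (renTy ρ' S) = renTy (ρ ∘ ρ') S := by
  induction S generalizing ρ ρ' <;> simp_all [renTy, liftRen_comp]

theorem renTy_liftRen_succ (ρ : Nat → Nat) (S : Ty) :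
    renTy (liftRen ρ) (renTy Nat.succ S) = renTy Nat.succ (renTy ρ S) := by
  simp only [renTy_renTy]; rfl

theorem liftTySub_liftRen (σ : Nat → Ty) (ρ : Nat → Nat) :
    liftTySub σ ∘ liftRen ρ = liftTySub (σ ∘ ρ) := by
  funext n; cases n <;> rfl

theorem subTy_renTy (S : Ty) (σ : Nat → Ty) (ρ : Nat → Nat) :
    subTy σ (renTy ρ S) = subTy (σ ∘ ρ) S := by
  induction S generalizing σ ρ <;> simp_all [renTy, subTy, liftTySub_liftRen]

theorem renTy_comp_liftTySub (σ : Nat → Ty) (ρ : Nat → Nat) :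
    renTy (liftRen ρ) ∘ liftTySub σ = liftTySub (renTy ρ ∘ σ) := by
  funext n
  cases n with
  | zero => rfl
  | succ n => exact renTy_liftRen_succ ρ (σ n)

theorem renTy_subTy (S : Ty) (σ : Nat → Ty) (ρ : Nat → Nat) :
    renTy ρ (subTy σ S) = subTy (renTy ρ ∘ σ) S := by
  induction S generalizing σ ρ <;> simp_all [renTy, subTy, renTy_comp_liftTySub]

theorem subTy_liftTySub_succ (σ : Nat → Ty) (S : Ty) :
    subTy (liftTySub σ) (renTy Nat.succ S) = renTy Nat.succ (subTy σ S) := by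
  rw [subTy_renTy, renTy_subTy]; rfl

theorem subTy_comp_liftTySub (σ τ : Nat → Ty) :
    subTy (liftTySub σ) ∘ liftTySub τ = liftTySub (subTy σ ∘ τ) := by
  funext n
  cases n with
  | zero => rfl
  | succ n => exact subTy_liftTySub_succ σ (τ n)

theorem subTy_subTy (S : Ty) (σ τ : Nat → Ty) : subTy σ (subTy τ S) = subTy (subTy σ ∘ τ) S := by
  induction S generalizing σ τ <;> simp_all [subTy, subTy_comp_liftTySub]

theorem liftTySub_var : liftTySub Ty.var = Ty.var := by
  funext n; cases n <;> rfl

theorem subTy_var (S : Ty) : subTy Ty.var S = S := by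
  induction S <;> simp_all [subTy, liftTySub_var]

theorem subTy0_renTy_succ (V S : Ty) : subTy0 V (renTy Nat.succ S) = S := by
  rw [subTy0, subTy_renTy]; exact subTy_var S

theorem renTy_subTy0 (ρ : Nat → Nat) (V S : Ty) :
    renTy ρ (subTy0 V S) = subTy0 (renTy ρ V) (renTy (liftRen ρ) S) := by
  rw [subTy0, subTy0, renTy_subTy, subTy_renTy]
  congr 1; funext n; cases n <;> rfl

theorem subTy_subTy0 (σ : Nat → Ty) (V S : Ty) :
    subTy σ (subTy0 V S) = subTy0 (subTy σ V) (subTy (liftTySub σ) S) := by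
  rw [subTy0, subTy0, subTy_subTy, subTy_subTy]
  congr 1; funext n
  cases n with
  | zero => rfl
  | succ n => exact (subTy0_renTy_succ (subTy σ V) (σ n)).symm

/-! ### Typing is stable under renaming -/

/-- `ρx` maps variables of `Γ` to variables of `Γ'` of the renamed type. -/
def RenX (ρx ρa : Nat → Nat) (Γ Γ' : List Ty) : Prop :=
  ∀ x S, Γ[x]? = some S → Γ'[ρx x]? = some (renTy ρa S)

/-- `ρk` maps variables of `Δ` to variables of `Δ'` of the renamed type. -/
def RenK (ρk ρa : Nat → Nat) (Δ Δ' : List (Ty × Ty)) : Prop :=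
  ∀ k S T, Δ[k]? = some (S, T) → Δ'[ρk k]? = some (renTy ρa S, renTy ρa T)

section Renaming

variable {ρx ρk ρa : Nat → Nat} {Γ Γ' : List Ty} {Δ Δ' : List (Ty × Ty)}

theorem RenX.lift (h : RenX ρx ρa Γ Γ') (S : Ty) :
    RenX (liftRen ρx) ρa (S :: Γ) (renTy ρa S :: Γ') := by
  intro x T hx
  cases x with
  | zero => simp_all [liftRen]
  | succ x => simpa [liftRen] using h x T (by simpa using hx)

theorem RenK.lift (h : RenK ρk ρa Δ Δ') (S T : Ty) :
    RenK (liftRen ρk) ρa ((S, T) :: Δ) ((renTy ρa S, renTy ρa T) :: Δ') := by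
  intro k A B hk
  cases k with
  | zero => simp_all [liftRen]
  | succ k => simpa [liftRen] using h k A B (by simpa using hk)

theorem RenX.liftTy (h : RenX ρx ρa Γ Γ') :
    RenX ρx (liftRen ρa) (Γ.map (renTy Nat.succ)) (Γ'.map (renTy Nat.succ)) := by
  intro x S hx
  simp only [List.getElem?_map, Option.map_eq_some_iff] at hx ⊢
  obtain ⟨S, hx, rfl⟩ := hx
  exact ⟨_, h x S hx, (renTy_liftRen_succ ρa S).symm⟩

theorem RenK.liftTy (h : RenK ρk ρa Δ Δ') :
    RenK ρk (liftRen ρa) (Δ.map (fun C => (renTy Nat.succ C.1, renTy Nat.succ C.2)))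
      (Δ'.map (fun C => (renTy Nat.succ C.1, renTy Nat.succ C.2))) := by
  intro k S T hk
  simp only [List.getElem?_map, Option.map_eq_some_iff, Prod.mk.injEq] at hk ⊢
  obtain ⟨⟨S, T⟩, hk, rfl, rfl⟩ := hk
  exact ⟨_, h k S T hk, (renTy_liftRen_succ ρa S).symm, (renTy_liftRen_succ ρa T).symm⟩

end Renaming

mutual

theorem HasTy.ren {Γ Δ T S U} : ∀ {t : Tm}, HasTy Γ Δ T t S U → ∀ {ρx ρk ρa : Nat → Nat} {Γ' Δ'},
    RenX ρx ρa Γ Γ' → RenK ρk ρa Δ Δ' →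
    HasTy Γ' Δ' (renTy ρa T) (renTm ρx ρk ρa t) (renTy ρa S) (renTy ρa U)
  | .var _, h, _, _, _, _, _, hx, hk => by
    cases h with
    | var h => exact .var (hx _ _ h)
  | .lam _ t, h, _, _, _, _, _, hx, hk => by
    cases h with
    | lam h => exact .lam (HasTy.ren (t := t) h (hx.lift _) hk)
  | .app t₀ t₁, h, _, _, _, _, _, hx, hk => by
    cases h with
    | app h₀ h₁ => exact .app (HasTy.ren (t := t₀) h₀ hx hk) (HasTy.ren (t := t₁) h₁ hx hk)
  | .tlam t, h, _, _, _, _, _, hx, hk => by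
    cases h with
    | tlam h => exact .tlam (HasTy.ren (t := t) h hx.liftTy hk.liftTy)
  | .tapp t _, h, _, _, _, _, _, hx, hk => by
    cases h with
    | tapp h =>
      have h := HasTy.ren (t := t) h hx hk
      rw [renTy_subTy0] at h
      rw [renTy_subTy0, renTy_subTy0]
      exact .tapp h
  | .shift t, h, _, _, _, _, _, hx, hk => by
    cases h with
    | shift h => exact .shift (HasTy.ren (t := t) h hx (hk.lift _ _))
  | .reset t, h, _, _, _, _, _, hx, hk => by
    cases h with
    | reset h => exact .reset (HasTy.ren (t := t) h hx hk)
  | .throwVar k t, h, _, _, _, _, _, hx, hk => by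
    cases h with
    | throwVar h₀ h =>
      exact .throwVar (hk _ _ _ h₀) (HasTy.ren (t := t) h hx hk)
  | .throwCtx E t, h, _, _, _, _, _, hx, hk => by
    cases h with
    | throwCtx h₀ h =>
      exact .throwCtx (HasTyCtx.ren (E := E) h₀ hx hk) (HasTy.ren (t := t) h hx hk)

theorem HasTyCtx.ren {Γ Δ S T} : ∀ {E : Ctx}, HasTyCtx Γ Δ E S T → ∀ {ρx ρk ρa : Nat → Nat} {Γ' Δ'},
    RenX ρx ρa Γ Γ' → RenK ρk ρa Δ Δ' →
    HasTyCtx Γ' Δ' (renCtx ρx ρk ρa E) (renTy ρa S) (renTy ρa T)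
  | .hole, h, _, _, _, _, _, _, _ => by
    cases h
    exact .hole
  | .lamApp _ t E, h, _, _, ρa, _, _, hx, hk => by
    cases h with
    | @lamApp _ _ _ _ _ _ W _ _ h₀ h =>
      cases h₀ with
      | lam h₀ =>
        exact .lamApp (W := renTy ρa W) (.lam (HasTy.ren (t := t) h₀ (hx.lift _) hk))
          (HasTyCtx.ren (E := E) h hx hk)
  | .app E t, h, _, _, _, _, _, hx, hk => by
    cases h with
    | app h₀ h => exact .app (HasTyCtx.ren (E := E) h₀ hx hk) (HasTy.ren (t := t) h hx hk)
  | .tapp E _, h, _, _, _, _, _, hx, hk => by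
    cases h with
    | tapp h =>
      have h := HasTyCtx.ren (E := E) h hx hk
      rw [renTy_subTy0, renTy_subTy0] at h
      rw [renTy_subTy0]
      exact .tapp h
  | .throw E₀ E, h, _, _, _, _, _, hx, hk => by
    cases h with
    | throw h₀ h =>
      exact .throw (HasTyCtx.ren (E := E₀) h₀ hx hk) (HasTyCtx.ren (E := E) h hx hk)

end

/-! ### Typing is stable under substitution -/

/-- A continuation-substitution entry has type `¬(S,T)`. -/
def HasTyKEnt (Γ : List Ty) (Δ : List (Ty × Ty)) : Ctx ⊕ Nat → Ty → Ty → Prop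
  | .inl E, S, T => HasTyCtx Γ Δ E S T
  | .inr m, S, T => Δ[m]? = some (S, T)

/-- Terms whose evaluation has no effect on the answer type. -/
inductive IsPure : Tm → Prop where
  | var : ∀ {x}, IsPure (.var x)
  | lam : ∀ {S t}, IsPure (.lam S t)
  | tlam : ∀ {t}, IsPure (.tlam t)

theorem IsValue.isPure {v : Tm} (h : IsValue v) : IsPure v := by
  cases h <;> constructor

theorem IsPure.ren {t : Tm} (h : IsPure t) (ρx ρk ρa : Nat → Nat) :
    IsPure (renTm ρx ρk ρa t) := by
  cases h <;> constructor

theorem HasTy.answer_eq {Γ Δ T t S U} (h : HasTy Γ Δ T t S U) (ht : IsPure t) : T = U := by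
  cases ht <;> cases h <;> rfl

theorem HasTy.any_answer {Γ Δ T t S U} (h : HasTy Γ Δ T t S U) (ht : IsPure t) (W : Ty) :
    HasTy Γ Δ W t S W := by
  cases ht with
  | var => cases h with | var h => exact .var h
  | lam => cases h with | lam h => exact .lam h
  | tlam => cases h with | tlam h => exact .tlam h

/-- `σx` maps variables of `Γ` to pure terms of the substituted type. -/
def SubX (σx : Nat → Tm) (σa : Nat → Ty) (Γ Γ' : List Ty) (Δ' : List (Ty × Ty)) : Prop :=
  ∀ x S, Γ[x]? = some S → IsPure (σx x) ∧ ∀ W, HasTy Γ' Δ' W (σx x) (subTy σa S) W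

/-- `σk` maps variables of `Δ` to contexts or variables of the substituted type. -/
def SubK (σk : Nat → Ctx ⊕ Nat) (σa : Nat → Ty) (Δ : List (Ty × Ty)) (Γ' : List Ty)
    (Δ' : List (Ty × Ty)) : Prop :=
  ∀ k S T, Δ[k]? = some (S, T) → HasTyKEnt Γ' Δ' (σk k) (subTy σa S) (subTy σa T)

theorem renX_succ (Γ : List Ty) (S : Ty) : RenX Nat.succ id Γ (S :: Γ) := by
  intro x T hx; simpa [renTy_id] using hx

theorem renK_succ (Δ : List (Ty × Ty)) (C : Ty × Ty) : RenK Nat.succ id Δ (C :: Δ) := by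
  intro k S T hk; simpa [renTy_id] using hk

theorem renX_id (Γ : List Ty) : RenX id id Γ Γ := by
  intro x T hx; simpa [renTy_id] using hx

theorem renK_id (Δ : List (Ty × Ty)) : RenK id id Δ Δ := by
  intro k S T hk; simpa [renTy_id] using hk

theorem renX_map (Γ : List Ty) : RenX id Nat.succ Γ (Γ.map (renTy Nat.succ)) := by
  intro x T hx; simp [hx]

theorem renK_map (Δ : List (Ty × Ty)) : RenK id Nat.succ Δ
    (Δ.map (fun C => (renTy Nat.succ C.1, renTy Nat.succ C.2))) := by
  intro k S T hk; simp [hk]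

theorem IsPure.hasTy_ren {t : Tm} (ht : IsPure t) {ρx ρk ρa : Nat → Nat} {Γ Γ' Δ Δ' S}
    (h : ∀ W, HasTy Γ Δ W t S W) (hx : RenX ρx ρa Γ Γ') (hk : RenK ρk ρa Δ Δ') (W : Ty) :
    HasTy Γ' Δ' W (renTm ρx ρk ρa t) (renTy ρa S) W :=
  ((h S).ren hx hk).any_answer (ht.ren _ _ _) W

section Substitution

variable {σx : Nat → Tm} {σk : Nat → Ctx ⊕ Nat} {σa : Nat → Ty}
  {Γ Γ' : List Ty} {Δ Δ' : List (Ty × Ty)}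

theorem SubX.lift (h : SubX σx σa Γ Γ' Δ') (S : Ty) :
    SubX (liftSubX σx) σa (S :: Γ) (subTy σa S :: Γ') Δ' := by
  intro x T hx
  cases x with
  | zero =>
    obtain rfl : S = T := by simpa using hx
    exact ⟨.var, fun W => .var rfl⟩
  | succ x =>
    obtain ⟨hp, ht⟩ := h x T (by simpa using hx)
    refine ⟨hp.ren _ _ _, fun W => ?_⟩
    have := hp.hasTy_ren ht (renX_succ Γ' (subTy σa S)) (renK_id Δ') W
    rwa [renTy_id] at this

theorem SubX.shiftK (h : SubX σx σa Γ Γ' Δ') (C : Ty × Ty) :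
    SubX (shiftSubXk σx) σa Γ Γ' (C :: Δ') := by
  intro x T hx
  obtain ⟨hp, ht⟩ := h x T hx
  refine ⟨hp.ren _ _ _, fun W => ?_⟩
  have := hp.hasTy_ren ht (renX_id Γ') (renK_succ Δ' C) W
  rwa [renTy_id] at this

theorem SubX.liftTy (h : SubX σx σa Γ Γ' Δ') :
    SubX (shiftSubXa σx) (liftTySub σa) (Γ.map (renTy Nat.succ)) (Γ'.map (renTy Nat.succ))
      (Δ'.map (fun C => (renTy Nat.succ C.1, renTy Nat.succ C.2))) := by
  intro x T hx
  simp only [List.getElem?_map, Option.map_eq_some_iff] at hx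
  obtain ⟨S, hx, rfl⟩ := hx
  obtain ⟨hp, ht⟩ := h x S hx
  refine ⟨hp.ren _ _ _, fun W => ?_⟩
  rw [subTy_liftTySub_succ]
  exact hp.hasTy_ren ht (renX_map Γ') (renK_map Δ') W

theorem SubK.shiftX (h : SubK σk σa Δ Γ' Δ') (S : Ty) :
    SubK (shiftSubKx σk) σa Δ (S :: Γ') Δ' := by
  intro k A B hk
  have := h k A B hk
  simp only [shiftSubKx]
  cases hσ : σk k with
  | inl E =>
    rw [hσ] at this
    have := HasTyCtx.ren this (renX_succ Γ' S) (renK_id Δ')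
    rwa [renTy_id, renTy_id] at this
  | inr m => rwa [hσ] at this

theorem SubK.lift (h : SubK σk σa Δ Γ' Δ') (S T : Ty) :
    SubK (liftSubK σk) σa ((S, T) :: Δ) Γ' ((subTy σa S, subTy σa T) :: Δ') := by
  intro k A B hk
  cases k with
  | zero =>
    obtain ⟨rfl, rfl⟩ : S = A ∧ T = B := by simpa using hk
    rfl
  | succ k =>
    have := h k A B (by simpa using hk)
    simp only [liftSubK]
    cases hσ : σk k with
    | inl E =>
      rw [hσ] at this
      have := HasTyCtx.ren this (renX_id Γ') (renK_succ Δ' (subTy σa S, subTy σa T))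
      rwa [renTy_id, renTy_id] at this
    | inr m => rwa [hσ] at this

theorem SubK.liftTy (h : SubK σk σa Δ Γ' Δ') :
    SubK (shiftSubKa σk) (liftTySub σa)
      (Δ.map (fun C => (renTy Nat.succ C.1, renTy Nat.succ C.2))) (Γ'.map (renTy Nat.succ))
      (Δ'.map (fun C => (renTy Nat.succ C.1, renTy Nat.succ C.2))) := by
  intro k A B hk
  simp only [List.getElem?_map, Option.map_eq_some_iff, Prod.mk.injEq] at hk
  obtain ⟨⟨A, B⟩, hk, rfl, rfl⟩ := hk
  have := h k A B hk
  simp only [shiftSubKa, subTy_liftTySub_succ]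
  cases hσ : σk k with
  | inl E =>
    rw [hσ] at this
    exact HasTyCtx.ren this (renX_map Γ') (renK_map Δ')
  | inr m =>
    rw [hσ] at this
    exact renK_map Δ' _ _ _ this

end Substitution

mutual

theorem HasTy.sub {Γ Δ T S U} : ∀ {t : Tm}, HasTy Γ Δ T t S U → ∀ {σx : Nat → Tm} {σk : Nat → Ctx ⊕ Nat} {σa : Nat → Ty} {Γ' Δ'},
    SubX σx σa Γ Γ' Δ' → SubK σk σa Δ Γ' Δ' →
    HasTy Γ' Δ' (subTy σa T) (subTm σx σk σa t) (subTy σa S) (subTy σa U)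
  | .var _, h, _, _, _, _, _, hx, hk => by
    cases h with
    | var h => exact (hx _ _ h).2 _
  | .lam _ t, h, _, _, _, _, _, hx, hk => by
    cases h with
    | lam h => exact .lam (HasTy.sub (t := t) h (hx.lift _) (hk.shiftX _))
  | .app t₀ t₁, h, _, _, _, _, _, hx, hk => by
    cases h with
    | app h₀ h₁ => exact .app (HasTy.sub (t := t₀) h₀ hx hk) (HasTy.sub (t := t₁) h₁ hx hk)
  | .tlam t, h, _, _, _, _, _, hx, hk => by
    cases h with
    | tlam h => exact .tlam (HasTy.sub (t := t) h hx.liftTy hk.liftTy)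
  | .tapp t _, h, _, _, _, _, _, hx, hk => by
    cases h with
    | tapp h =>
      have h := HasTy.sub (t := t) h hx hk
      rw [subTy_subTy0] at h
      rw [subTy_subTy0, subTy_subTy0]
      exact .tapp h
  | .shift t, h, _, _, _, _, _, hx, hk => by
    cases h with
    | shift h => exact .shift (HasTy.sub (t := t) h (hx.shiftK _) (hk.lift _ _))
  | .reset t, h, _, _, _, _, _, hx, hk => by
    cases h with
    | reset h => exact .reset (HasTy.sub (t := t) h hx hk)
  | .throwVar k t, h, _, σk, _, _, _, hx, hk => by
    cases h with
    | throwVar h₀ h =>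
      have h₀ := hk _ _ _ h₀
      simp only [subTm]
      cases hσ : σk k with
      | inl E => rw [hσ] at h₀; exact .throwCtx h₀ (HasTy.sub (t := t) h hx hk)
      | inr m => rw [hσ] at h₀; exact .throwVar h₀ (HasTy.sub (t := t) h hx hk)
  | .throwCtx E t, h, _, _, _, _, _, hx, hk => by
    cases h with
    | throwCtx h₀ h =>
      exact .throwCtx (HasTyCtx.sub (E := E) h₀ hx hk) (HasTy.sub (t := t) h hx hk)

theorem HasTyCtx.sub {Γ Δ S T} : ∀ {E : Ctx}, HasTyCtx Γ Δ E S T → ∀ {σx : Nat → Tm} {σk : Nat → Ctx ⊕ Nat} {σa : Nat → Ty} {Γ' Δ'},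
    SubX σx σa Γ Γ' Δ' → SubK σk σa Δ Γ' Δ' →
    HasTyCtx Γ' Δ' (subCtx σx σk σa E) (subTy σa S) (subTy σa T)
  | .hole, h, _, _, _, _, _, _, _ => by
    cases h
    exact .hole
  | .lamApp _ t E, h, _, _, σa, _, _, hx, hk => by
    cases h with
    | @lamApp _ _ _ _ _ _ W _ _ h₀ h =>
      cases h₀ with
      | lam h₀ =>
        exact .lamApp (W := subTy σa W) (.lam (HasTy.sub (t := t) h₀ (hx.lift _) (hk.shiftX _)))
          (HasTyCtx.sub (E := E) h hx hk)
  | .app E t, h, _, _, _, _, _, hx, hk => by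
    cases h with
    | app h₀ h => exact .app (HasTyCtx.sub (E := E) h₀ hx hk) (HasTy.sub (t := t) h hx hk)
  | .tapp E _, h, _, _, _, _, _, hx, hk => by
    cases h with
    | tapp h =>
      have h := HasTyCtx.sub (E := E) h hx hk
      rw [subTy_subTy0, subTy_subTy0] at h
      rw [subTy_subTy0]
      exact .tapp h
  | .throw E₀ E, h, _, _, _, _, _, hx, hk => by
    cases h with
    | throw h₀ h =>
      exact .throw (HasTyCtx.sub (E := E₀) h₀ hx hk) (HasTyCtx.sub (E := E) h hx hk)

end

section SingleSubstitution

variable {Γ : List Ty} {Δ : List (Ty × Ty)} {S T U V : Ty} {t v : Tm}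

theorem subX_var (Γ : List Ty) (Δ : List (Ty × Ty)) : SubX Tm.var Ty.var Γ Γ Δ := by
  intro x S hx
  rw [subTy_var]
  exact ⟨.var, fun _ => .var hx⟩

theorem subK_inr (Γ : List Ty) (Δ : List (Ty × Ty)) : SubK Sum.inr Ty.var Δ Γ Δ := by
  intro k S T hk
  rw [subTy_var, subTy_var]
  exact hk

theorem HasTy.sub0X (h : HasTy (V :: Γ) Δ T t S U) (hv : IsPure v)
    (hvt : ∀ W, HasTy Γ Δ W v V W) : HasTy Γ Δ T (sub0X v t) S U := by
  have := h.sub (σx := fun n => match n with | 0 => v | n+1 => .var n) (σa := Ty.var) (Γ' := Γ)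
    (by
      intro x S hx
      rw [subTy_var]
      cases x with
      | zero =>
        obtain rfl : V = S := by simpa using hx
        exact ⟨hv, hvt⟩
      | succ x => exact ⟨.var, fun W => .var (by simpa using hx)⟩)
    (subK_inr Γ Δ)
  simp only [subTy_var] at this
  exact this

theorem HasTy.sub0K {E : Ctx} {A B : Ty} (h : HasTy Γ ((A, B) :: Δ) T t S U)
    (hE : HasTyCtx Γ Δ E A B) : HasTy Γ Δ T (sub0K E t) S U := by
  have := h.sub (σk := fun n => match n with | 0 => .inl E | n+1 => .inr n) (σa := Ty.var)
    (subX_var Γ Δ)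
    (by
      intro k S T hk
      rw [subTy_var, subTy_var]
      cases k with
      | zero =>
        obtain ⟨rfl, rfl⟩ : A = S ∧ B = T := by simpa using hk
        exact hE
      | succ k => simpa [HasTyKEnt] using hk)
  simp only [subTy_var] at this
  exact this

theorem HasTy.sub0A (h : HasTy (Γ.map (renTy Nat.succ))
      (Δ.map (fun C => (renTy Nat.succ C.1, renTy Nat.succ C.2))) T t S U) (V : Ty) :
    HasTy Γ Δ (subTy0 V T) (sub0A V t) (subTy0 V S) (subTy0 V U) := by
  refine h.sub ?_ ?_
  · intro x S hx
    simp only [List.getElem?_map, Option.map_eq_some_iff] at hx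
    obtain ⟨S, hx, rfl⟩ := hx
    refine ⟨.var, fun W => ?_⟩
    change HasTy Γ Δ W (.var x) (subTy0 V (renTy Nat.succ S)) W
    rw [subTy0_renTy_succ]
    exact .var hx
  · intro k A B hk
    simp only [List.getElem?_map, Option.map_eq_some_iff, Prod.mk.injEq] at hk
    obtain ⟨⟨A, B⟩, hk, rfl, rfl⟩ := hk
    change Δ[k]? = some (subTy0 V (renTy Nat.succ A), subTy0 V (renTy Nat.succ B))
    rw [subTy0_renTy_succ, subTy0_renTy_succ]
    exact hk

end SingleSubstitution

/-! ### Plugging -/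

theorem HasTy.unplug {Γ Δ} : ∀ {E : Ctx} {t : Tm} {S V : Ty}, HasTy Γ Δ S (plug t E) S V →
    ∃ A B, HasTy Γ Δ B t A V ∧ HasTyCtx Γ Δ E A B
  | .hole, _, S, _, h => ⟨S, S, h, .hole⟩
  | .lamApp _ _ E, _, S, _, h => by
    obtain ⟨A, B, h, hE⟩ := HasTy.unplug (E := E) h
    cases h with
    | app h₀ h₁ =>
      obtain rfl := h₀.answer_eq .lam
      cases h₀ with
      | lam h₀ => exact ⟨_, _, h₁, .lamApp (W := B) (.lam h₀) hE⟩
  | .app E _, _, _, _, h => by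
    obtain ⟨A, B, h, hE⟩ := HasTy.unplug (E := E) h
    cases h with
    | app h₀ h₁ => exact ⟨_, _, h₀, .app hE h₁⟩
  | .tapp E _, _, _, _, h => by
    obtain ⟨A, B, h, hE⟩ := HasTy.unplug (E := E) h
    cases h with
    | tapp h => exact ⟨_, _, h, .tapp hE⟩
  | .throw _ E, _, _, _, h => by
    obtain ⟨A, B, h, hE⟩ := HasTy.unplug (E := E) h
    cases h with
    | throwCtx h₀ h => exact ⟨_, _, h, .throw h₀ hE⟩

theorem HasTyCtx.plug {Γ Δ} : ∀ {E : Ctx} {A B : Ty}, HasTyCtx Γ Δ E A B →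
    ∀ {t : Tm} {V : Ty}, HasTy Γ Δ B t A V → ∃ W, HasTy Γ Δ W (plug t E) W V
  | .hole, _, _, hE, _, _, h => by cases hE; exact ⟨_, h⟩
  | .lamApp _ _ E, _, _, hE, _, _, h => by
    cases hE with
    | lamApp h₀ hE => exact HasTyCtx.plug hE (.app (h₀.any_answer .lam _) h)
  | .app E _, _, _, hE, _, _, h => by
    cases hE with
    | app hE h₁ => exact HasTyCtx.plug hE (.app h h₁)
  | .tapp E _, _, _, hE, _, _, h => by
    cases hE with
    | tapp hE => exact HasTyCtx.plug hE (.tapp h)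
  | .throw _ E, _, _, hE, _, _, h => by
    cases hE with
    | throw h₀ hE => exact HasTyCtx.plug hE (.throwCtx h₀ h)

/-- Replacing a delimited term in a metacontext, when the replacement has all its types. -/
theorem HasTy.plugm_mono {Γ Δ} {t t' : Tm}
    (ht : ∀ T S U, HasTy Γ Δ T t S U → HasTy Γ Δ T t' S U) {F : MCtx} {T S U : Ty}
    (h : HasTy Γ Δ T (plugm t F) S U) : HasTy Γ Δ T (plugm t' F) S U := by
  induction F generalizing t t' with
  | nil => exact ht _ _ _ h
  | cons E F ih =>
    refine ih (fun T S U h => ?_) h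
    cases h with
    | reset h =>
      obtain ⟨A, B, h, hE⟩ := h.unplug
      obtain ⟨W, h⟩ := hE.plug (ht _ _ _ h)
      exact .reset h

theorem HasTy.beta {Γ Δ T A U V v b} (hv : IsValue v)
    (h : HasTy Γ Δ T (.app (.lam V b) v) A U) : HasTy Γ Δ T (LambdaFShift.sub0X v b) A U := by
  cases h with
  | app h₀ h₁ =>
    obtain rfl := h₀.answer_eq .lam
    obtain rfl := h₁.answer_eq hv.isPure
    cases h₀ with
    | lam h₀ => exact h₀.sub0X hv.isPure (h₁.any_answer hv.isPure)

theorem HasTy.tlam_body {Γ Δ W V A B C b} (h : HasTy Γ Δ W (.tlam b) (.all A B C) V) :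
    HasTy (Γ.map (renTy Nat.succ))
      (Δ.map (fun C => (renTy Nat.succ C.1, renTy Nat.succ C.2))) B b A C := by
  cases h with
  | tlam h => exact h

theorem HasTy.betaT {Γ Δ T A U V b} (h : HasTy Γ Δ T (.tapp (.tlam b) V) A U) :
    HasTy Γ Δ T (LambdaFShift.sub0A V b) A U := by
  cases h with
  | tapp h =>
    obtain rfl := h.answer_eq .tlam
    exact h.tlam_body.sub0A V

theorem HasTy.reset_value {Γ Δ T A U v} (hv : IsValue v) (h : HasTy Γ Δ T (.reset v) A U) :
    HasTy Γ Δ T v A U := by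
  cases h with
  | reset h =>
    obtain rfl := h.answer_eq hv.isPure
    exact h.any_answer hv.isPure _

theorem HasTy.shift_step {Γ Δ T A U E b} (h : HasTy Γ Δ T (.reset (plug (.shift b) E)) A U) :
    HasTy Γ Δ T (.reset (LambdaFShift.sub0K E b)) A U := by
  cases h with
  | reset h =>
    obtain ⟨A, B, h, hE⟩ := h.unplug
    cases h with
    | shift h => exact .reset (h.sub0K hE)

theorem HasTy.throw_step {Γ Δ T A U E v} (hv : IsValue v) (h : HasTy Γ Δ T (.throwCtx E v) A U) :
    HasTy Γ Δ T (.reset (plug v E)) A U := by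
  cases h with
  | throwCtx hE h =>
    obtain rfl := h.answer_eq hv.isPure
    obtain ⟨W, h⟩ := hE.plug (h.any_answer hv.isPure _)
    exact .reset h

/-- **Subject reduction for `λF_{S,v}`.**  The call-by-value reduction rules
preserve types: if a well-typed program `p` (a closed plain term delimited by
a reset, typable in the empty environments) reduces in one step to `p'` by
`→v`, then `p'` is well-typed with the same type. -/
theorem subject_reduction
    (p p' : Tm) (S T U : Ty)
    (hclosed : ClosedTm p) (hplain : Plain p) (hreset : ∃ t, p = Tm.reset t)
    (hty : HasTy ([] : List Ty) ([] : List (Ty × Ty)) T p S U)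
    (hstep : Step p p') :
    HasTy ([] : List Ty) ([] : List (Ty × Ty)) T p' S U := by
  cases hstep with
  | beta hv => exact hty.plugm_mono (F := _ :: _) fun _ _ _ h => h.beta hv
  | betaT => exact hty.plugm_mono (F := _ :: _) fun _ _ _ h => h.betaT
  | @shift _ _ F => exact HasTy.plugm_mono (F := F) (fun _ _ _ h => h.shift_step) hty
  | @throw E' E F _ hv =>
    exact HasTy.plugm_mono (F := E :: F) (fun _ _ _ h => h.throw_step hv) hty
  | reset hv => exact hty.plugm_mono (F := _ :: _) fun _ _ _ h => h.reset_value hv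

end LambdaFShift
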